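/- arXiv:1204.5958 — 2 statements merged into one kernel-verified Lean document; each statement's English description precedes it below -/
import Mathlib

section
/- Let N be a prime power and select rows indexed by ℳ ⊆ ℤ_N from the N×N discrete Fourier transform matrix. The resulting |ℳ|×N matrix is full spark if and only if ℳ is uniformly distributed over the divisors of N, meaning for every divisor d of N, each of the d cosets of dℤ_N intersects ℳ in either ⌊|ℳ|/d⌋ or ⌈|ℳ|/d⌉ elements. -/
/-- The `N × N` discrete Fourier transform matrix, `ω^{mn}` with `ω = e^{-2πi/N}`. -/
noncomputable def dftMatrix (N : ℕ) [NeZero N] : Matrix (ZMod N) (ZMod N) ℂ :=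
  Matrix.of fun m n : ZMod N =>
    Complex.exp (-(2 * Real.pi * Complex.I) * ((m.val : ℂ) * (n.val : ℂ)) / N)

/-- The row-submatrix of the DFT with rows indexed by `S` is full spark: every square
submatrix obtained by choosing `|S|` distinct columns is invertible. -/
def DFTFullSparkRows (N : ℕ) [NeZero N] (S : Finset (ZMod N)) : Prop :=
  ∀ g : {m : ZMod N // m ∈ S} → ZMod N, Function.Injective g →
    (Matrix.of fun i j : {m : ZMod N // m ∈ S} =>
      dftMatrix N (i : ZMod N) (g j)).det ≠ 0

/-- `ℳ ⊆ ℤ_N` is uniformly distributed over the divisors of `N`: for every divisor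
`d` of `N`, each of the `d` cosets of `dℤ_N` (identified with the residues mod `d`)
meets `ℳ` in either `⌊|ℳ|/d⌋` or `⌈|ℳ|/d⌉` elements. -/
def UniformlyDistributed (N : ℕ) [NeZero N] (ℳ : Finset (ZMod N)) : Prop :=
  ∀ d : ℕ, d ∣ N → 0 < d → ∀ a : ℕ, a < d →
    (ℳ.filter fun m => m.val % d = a).card = ℳ.card / d ∨
    (ℳ.filter fun m => m.val % d = a).card = (ℳ.card + d - 1) / d

theorem eq_zero_of_sum_mul_choose_eq_zero_of_lt {K : Type*} [Field K] {p : ℕ} [CharP K p]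
    (T : Finset ℕ) (hT : ∀ m ∈ T, m < p) (c : ℕ → K)
    (h : ∀ i < T.card, ∑ m ∈ T, c m * (m.choose i : K) = 0) : ∀ m ∈ T, c m = 0 := by
  classical
  induction T using Finset.induction_on generalizing c with
  | empty => simp
  | insert t T ht ih =>
    rw [Finset.card_insert_of_notMem ht] at h
    have hzero : ∀ m ∈ T, ((m : K) - t) * c m = 0 := by
      refine ih (fun m hm => hT m (Finset.mem_insert_of_mem hm)) (fun m => ((m : K) - t) * c m) ?_
      intro i hi
      have h₁ := h i (by omega)
      have h₂ := h (i + 1) (by omega)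
      have key : ∀ m : ℕ, ((m : K) - t) * c m * (m.choose i : K) =
          (i + 1) * (c m * (m.choose (i + 1) : K)) + (i - t) * (c m * (m.choose i : K)) := by
        intro m
        have e : (m : K) * (m.choose i : K) =
            (i + 1) * (m.choose (i + 1) : K) + i * (m.choose i : K) := by
          rcases le_or_gt i m with him | him
          · have := Nat.choose_succ_right_eq m i
            obtain ⟨j, rfl⟩ := Nat.exists_eq_add_of_le him
            rw [Nat.add_sub_cancel_left] at this
            have := congrArg (Nat.cast : ℕ → K) this
            push_cast at this ⊢
            linear_combination -this
          · simp [Nat.choose_eq_zero_of_lt him, Nat.choose_eq_zero_of_lt (show m < i + 1 by omega)]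
        linear_combination c m * e
      have hs : ∑ m ∈ insert t T, ((m : K) - t) * c m * (m.choose i : K) = 0 := by
        simp_rw [key]
        rw [Finset.sum_add_distrib, ← Finset.mul_sum, ← Finset.mul_sum, h₁, h₂]
        simp
      simpa [Finset.sum_insert ht] using hs
    have hc : ∀ m ∈ T, c m = 0 := by
      intro m hm
      refine (mul_eq_zero.mp (hzero m hm)).resolve_left fun hmt => ht ?_
      have := (CharP.natCast_eq_natCast K p).mp (sub_eq_zero.mp hmt)
      rw [← Nat.ModEq.eq_of_lt_of_lt this (hT m (Finset.mem_insert_of_mem hm))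
        (hT t (Finset.mem_insert_self t T))]
      exact hm
    have h₀ := h 0 (by omega)
    rw [Finset.sum_insert ht, Finset.sum_eq_zero (fun m hm => by rw [hc m hm, zero_mul])] at h₀
    intro m hm
    rcases Finset.mem_insert.mp hm with rfl | hm
    · simpa using h₀
    · exact hc m hm

theorem le_and_le_of_sum_eq_of_le_add_one {p q r : ℕ} (n : ℕ → ℕ) (hr : r < p)
    (hsum : ∑ a ∈ Finset.range p, n a = p * q + r)
    (hbal : ∀ a < p, ∀ b < p, n a ≤ n b + 1) :
    (∀ a < p, n a ≤ q + 1) ∧ ((Finset.range p).filter fun a => q < n a).card ≤ r := by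
  have hlow : ∀ a < p, q ≤ n a := by
    intro a ha
    by_contra! hlt
    have := Finset.sum_lt_sum (s := Finset.range p) (f := n) (g := fun _ => q)
      (fun b hb => by have := hbal b (Finset.mem_range.mp hb) a ha; omega)
      ⟨a, Finset.mem_range.mpr ha, hlt⟩
    simp at this
    omega
  refine ⟨fun a ha => ?_, ?_⟩
  · by_contra! hlt
    have := Finset.sum_le_sum (s := Finset.range p) (f := fun _ => q + 1) (g := n)
      (fun b hb => by have := hbal a ha b (Finset.mem_range.mp hb); omega)
    simp at this
    nlinarith
  · have : ∑ a ∈ Finset.range p, (q + if q < n a then 1 else 0) ≤ ∑ a ∈ Finset.range p, n a :=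
      Finset.sum_le_sum fun a ha => by
        have := hlow a (Finset.mem_range.mp ha)
        split_ifs <;> omega
    rw [Finset.sum_add_distrib, ← Finset.card_filter] at this
    simp only [Finset.sum_const, Finset.card_range, smul_eq_mul] at this
    omega

/-- Kernel triviality of the matrix of binomial coefficients `m.choose i` modulo `p`, for row
indices `m < p ^ k` balanced over the residue classes modulo each `p ^ e`. -/
theorem eq_zero_of_sum_mul_choose_eq_zero {K : Type*} [Field K] {p : ℕ} [Fact p.Prime] [CharP K p]
    (k : ℕ) (S : Finset ℕ) (hS : ∀ m ∈ S, m < p ^ k)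
    (hbal : ∀ e ≤ k, ∀ a < p ^ e, ∀ b < p ^ e, (S.filter fun m => m % p ^ e = a).card ≤
      (S.filter fun m => m % p ^ e = b).card + 1)
    (c : ℕ → K) (h : ∀ i < S.card, ∑ m ∈ S, c m * (m.choose i : K) = 0) :
    ∀ m ∈ S, c m = 0 := by
  induction k generalizing S c with
  | zero =>
    intro m hm
    have hm0 : m = 0 := by simpa using hS m hm
    have : S = {0} := by
      ext x
      refine ⟨fun hx => by simpa using hS x hx, fun hx => ?_⟩
      rw [Finset.mem_singleton.mp hx, ← hm0]
      exact hm
    have := h 0 (Finset.card_pos.mpr ⟨m, hm⟩)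
    simp_all
  | succ k ih =>
    have hp : 0 < p := (Fact.out : p.Prime).pos
    set D : ℕ → Finset ℕ := fun a => (S.filter fun m => m % p = a).image (· / p) with hD
    have hinj : ∀ a, Set.InjOn (· / p) (S.filter fun m => m % p = a : Finset ℕ) := by
      intro a x hx y hy hxy
      simp only [Finset.coe_filter, Set.mem_ofPred_eq] at hx hy hxy
      rw [← Nat.div_add_mod x p, ← Nat.div_add_mod y p, hx.2, hy.2, hxy]
    have hDcard : ∀ a, (D a).card = (S.filter fun m => m % p = a).card := fun a =>
      Finset.card_image_of_injOn (hinj a)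
    have hmaps : ∀ m ∈ S, m % p ∈ Finset.range p := fun m _ =>
      Finset.mem_range.mpr (Nat.mod_lt m hp)
    have hDsum : ∀ a i, ∑ x ∈ D a, c (p * x + a) * (x.choose i : K) =
        ∑ m ∈ S with m % p = a, c m * ((m / p).choose i : K) := by
      intro a i
      rw [Finset.sum_image (hinj a)]
      refine Finset.sum_congr rfl fun m hm => ?_
      rw [Finset.mem_filter] at hm
      rw [← hm.2, Nat.div_add_mod]
    have hlucas : ∀ i₀ < p, ∀ i, p * i + i₀ < S.card → ∑ a ∈ Finset.range p,
        (∑ x ∈ D a, c (p * x + a) * (x.choose i : K)) * (a.choose i₀ : K) = 0 := by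
      intro i₀ hi₀ i hi
      rw [← h _ hi, ← Finset.sum_fiberwise_of_maps_to hmaps]
      refine Finset.sum_congr rfl fun a _ => ?_
      rw [hDsum, Finset.sum_mul]
      refine Finset.sum_congr rfl fun m hm => ?_
      have hl := (CharP.natCast_eq_natCast K p).mpr
        (Choose.choose_modEq_choose_mod_mul_choose_div_nat (n := m) (k := p * i + i₀) (p := p))
      rw [hl, (Finset.mem_filter.mp hm).2, Nat.mul_add_mod, Nat.mod_eq_of_lt hi₀,
        Nat.mul_add_div hp, Nat.div_eq_of_lt hi₀]
      push_cast
      rw [add_zero]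
      ring
    have hlt : ∀ a < p, ∀ i < S.card / p,
        ∑ x ∈ D a, c (p * x + a) * (x.choose i : K) = 0 := by
      intro a ha i hi
      refine eq_zero_of_sum_mul_choose_eq_zero_of_lt (p := p) (Finset.range p) (by simp)
        (fun a => ∑ x ∈ D a, c (p * x + a) * (x.choose i : K)) ?_ a (Finset.mem_range.mpr ha)
      intro i₀ hi₀
      rw [Finset.card_range] at hi₀
      refine hlucas i₀ hi₀ i ?_
      have := Nat.div_add_mod S.card p
      have := Nat.mul_le_mul_left p (Nat.succ_le_of_lt hi)
      rw [Nat.mul_succ] at this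
      omega
    have hDbal : ∀ a < p, ∀ e ≤ k, ∀ b < p ^ e, ∀ b' < p ^ e,
        ((D a).filter fun m => m % p ^ e = b).card ≤
          ((D a).filter fun m => m % p ^ e = b').card + 1 := by
      intro a ha e he b hb b' hb'
      have hcard : ∀ b < p ^ e, ((D a).filter fun m => m % p ^ e = b).card =
          (S.filter fun m => m % p ^ (e + 1) = a + p * b).card := by
        intro b _
        rw [hD, Finset.filter_image, Finset.card_image_of_injOn
          ((hinj a).mono (by intro x; simp; tauto)), Finset.filter_filter]
        congr 1
        refine Finset.filter_congr fun m _ => ?_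
        rw [pow_succ', Nat.mod_mul]
        constructor
        · rintro ⟨rfl, rfl⟩; rfl
        · intro hm
          have h₁ := congrArg (· % p) hm
          simp only [Nat.add_mul_mod_self_left, Nat.mod_mod, Nat.mod_eq_of_lt ha] at h₁
          rw [h₁] at hm
          exact ⟨h₁, Nat.eq_of_mul_eq_mul_left hp (Nat.add_left_cancel hm)⟩
      have hlt' : ∀ b < p ^ e, a + p * b < p ^ (e + 1) := by
        intro b hb
        rw [pow_succ']
        nlinarith
      rw [hcard b hb, hcard b' hb']
      exact hbal (e + 1) (by omega) _ (hlt' b hb) _ (hlt' b' hb')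
    have hDlt : ∀ a, ∀ m ∈ D a, m < p ^ k := by
      intro a m hm
      obtain ⟨x, hx, rfl⟩ := Finset.mem_image.mp hm
      have := hS x (Finset.mem_filter.mp hx).1
      rw [pow_succ'] at this
      exact Nat.div_lt_of_lt_mul this
    obtain ⟨hup, hR⟩ := le_and_le_of_sum_eq_of_le_add_one (p := p) (q := S.card / p)
      (r := S.card % p) (fun a => (D a).card) (Nat.mod_lt _ hp)
      (by
        rw [Nat.div_add_mod, Finset.card_eq_sum_card_fiberwise hmaps]
        simp [hDcard])
      (by
        intro a ha b hb
        have := hbal 1 (by omega) a (by simpa using ha) b (by simpa using hb)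
        simpa [hDcard] using this)
    have hsmall : ∀ a < p, (D a).card ≤ S.card / p → ∀ x ∈ D a, c (p * x + a) = 0 :=
      fun a ha hle => ih (D a) (hDlt a) (hDbal a ha) (fun x => c (p * x + a))
        fun i hi => hlt a ha i (hi.trans_le hle)
    have htop : ∀ a < p, ∑ x ∈ D a, c (p * x + a) * (x.choose (S.card / p) : K) = 0 := by
      have hout : ∀ a < p, (D a).card ≤ S.card / p →
          ∑ x ∈ D a, c (p * x + a) * (x.choose (S.card / p) : K) = 0 := fun a ha hle =>
        Finset.sum_eq_zero fun x hx => by rw [hsmall a ha hle x hx, zero_mul]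
      intro a ha
      rcases le_or_gt (D a).card (S.card / p) with hle | hgt
      · exact hout a ha hle
      refine eq_zero_of_sum_mul_choose_eq_zero_of_lt (p := p)
        ((Finset.range p).filter fun a => S.card / p < (D a).card)
        (fun m hm => Finset.mem_range.mp (Finset.mem_filter.mp hm).1)
        (fun a => ∑ x ∈ D a, c (p * x + a) * (x.choose (S.card / p) : K)) ?_ a
        (Finset.mem_filter.mpr ⟨Finset.mem_range.mpr ha, hgt⟩)
      intro i hi
      have hir : i < S.card % p := hi.trans_le hR
      have := Nat.div_add_mod S.card p
      rw [← hlucas i (hir.trans (Nat.mod_lt _ hp)) (S.card / p) (by omega)]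
      refine Finset.sum_subset (Finset.filter_subset _ _) fun b hb hb' => ?_
      rw [Finset.mem_filter, not_and, not_lt] at hb'
      rw [hout b (Finset.mem_range.mp hb) (hb' hb), zero_mul]
    intro m hm
    have ha := Nat.mod_lt m hp
    have := ih (D (m % p)) (hDlt _) (hDbal _ ha) (fun x => c (p * x + m % p))
      (fun i hi => by
        rcases Nat.lt_or_ge i (S.card / p) with hi' | hi'
        · exact hlt _ ha i hi'
        · have := hup _ ha
          obtain rfl : i = S.card / p := by omega
          exact htop _ ha)
      (m / p) (Finset.mem_image.mpr ⟨m, Finset.mem_filter.mpr ⟨hm, rfl⟩, rfl⟩)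
    simpa only [Nat.div_add_mod] using this

theorem exists_valuationSubring_charP_residueField (K : Type*) [Field K] [CharZero K] (p : ℕ)
    [hp : Fact p.Prime] : ∃ B : ValuationSubring K, CharP (IsLocalRing.ResidueField B) p := by
  let A : Subring K := (Int.castRingHom K).range
  have hI : Ideal.span {(p : A)} ≠ ⊤ := by
    rw [Ne, Ideal.span_singleton_eq_top]
    intro hu
    obtain ⟨⟨_, z, rfl⟩, hz⟩ := hu.exists_right_inv
    have := congrArg (Subtype.val) hz
    have h₁ : (p : ℤ) * z = 1 := by
      have h₂ : (p : K) * (z : K) = 1 := by simpa using this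
      exact_mod_cast h₂
    exact (Nat.prime_iff_prime_int.mp hp.out).not_isUnit (IsUnit.of_mul_eq_one _ h₁)
  obtain ⟨B, -, hB⟩ := Ideal.image_subset_nonunits_valuationSubring _ hI
  refine ⟨B, (CharP.charP_iff_prime_eq_zero hp.out).mpr ?_⟩
  have hpB : ((p : B) : K) ∈ B.nonunits := by
    refine hB ⟨p, Ideal.mem_span_singleton_self _, by simp⟩
  rw [ValuationSubring.coe_mem_nonunits_iff, ← IsLocalRing.residue_eq_zero_iff] at hpB
  simpa using hpB

theorem coeff_eq_zero_of_X_sub_one_pow_dvd {K : Type*} [Field K] {p k : ℕ} [Fact p.Prime]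
    [CharP K p] (S : Finset ℕ) (hS : ∀ m ∈ S, m < p ^ k)
    (hbal : ∀ e ≤ k, ∀ a < p ^ e, ∀ b < p ^ e, (S.filter fun m => m % p ^ e = a).card ≤
      (S.filter fun m => m % p ^ e = b).card + 1)
    (c : ℕ → K)
    (h : (Polynomial.X - 1 : Polynomial K) ^ S.card ∣ ∑ m ∈ S, Polynomial.monomial m (c m)) :
    ∀ m ∈ S, c m = 0 := by
  refine eq_zero_of_sum_mul_choose_eq_zero k S hS hbal c fun i hi => ?_
  have hX : (Polynomial.X : Polynomial K) ^ S.card ∣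
      Polynomial.taylor 1 (∑ m ∈ S, Polynomial.monomial m (c m)) := by
    obtain ⟨q, hq⟩ := h
    refine ⟨Polynomial.taylor 1 q, ?_⟩
    rw [hq, Polynomial.taylor_mul, Polynomial.taylor_pow]
    simp
  have := Polynomial.X_pow_dvd_iff.mp hX i hi
  rw [Polynomial.taylor_coeff, map_sum, Polynomial.eval_finsetSum] at this
  simpa [Polynomial.hasseDeriv_monomial, mul_comm] using this

/-- A polynomial supported on a balanced set of exponents `S` with `#S` distinct zeros among the
`p ^ k`-th roots of unity vanishes. -/
theorem eq_zero_of_sum_mul_pow_eq_zero {K : Type*} [Field K] [CharZero K] {p k : ℕ}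
    [Fact p.Prime] (S : Finset ℕ) (hS : ∀ m ∈ S, m < p ^ k)
    (hbal : ∀ e ≤ k, ∀ a < p ^ e, ∀ b < p ^ e, (S.filter fun m => m % p ^ e = a).card ≤
      (S.filter fun m => m % p ^ e = b).card + 1)
    (Z : Finset K) (hZ : ∀ z ∈ Z, z ^ p ^ k = 1) (hcard : S.card ≤ Z.card) (c : ℕ → K)
    (h : ∀ z ∈ Z, ∑ m ∈ S, c m * z ^ m = 0) : ∀ m ∈ S, c m = 0 := by
  classical
  obtain ⟨B, hB⟩ := exists_valuationSubring_charP_residueField K p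
  by_contra! hne
  obtain ⟨m₁, hm₁, hcm₁⟩ := hne
  obtain ⟨m₀, hm₀, hmax⟩ := S.exists_max_image (fun m => B.valuation (c m)) ⟨m₁, hm₁⟩
  have hc₀ : c m₀ ≠ 0 := by
    intro h₀
    have := hmax m₁ hm₁
    rw [h₀, map_zero, le_zero_iff, map_eq_zero] at this
    exact hcm₁ this
  have hmem : ∀ m ∈ S, c m / c m₀ ∈ B := by
    intro m hm
    rw [← B.valuation_le_one_iff, map_div₀]
    exact div_le_one_of_le₀ (hmax m hm) zero_le
  have hpos : p ^ k ≠ 0 := pow_ne_zero _ (Fact.out : p.Prime).ne_zero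
  have hZB : ∀ z ∈ Z, z ∈ B := by
    intro z hz
    refine (B.mem_or_inv_mem z).elim id fun hinv => ?_
    have hz1 := hZ z hz
    have hz₀ : z ≠ 0 := by
      rintro rfl
      rw [zero_pow hpos] at hz1
      exact zero_ne_one hz1
    obtain ⟨n, hn⟩ := Nat.exists_eq_succ_of_ne_zero hpos
    rw [hn, pow_succ] at hz1
    rw [eq_inv_of_mul_eq_one_right hz1, ← inv_pow]
    exact pow_mem hinv n
  set d : ℕ → B := fun m => if hm : m ∈ S then ⟨c m / c m₀, hmem m hm⟩ else 0 with hd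
  have hdval : ∀ m ∈ S, (d m : K) = c m / c m₀ := fun m hm => by simp [hd, hm]
  have hd₀ : d m₀ = 1 := Subtype.ext (by rw [hdval m₀ hm₀, div_self hc₀]; rfl)
  set f : Polynomial B := ∑ m ∈ S, Polynomial.monomial m (d m) with hf
  have hf₀ : f ≠ 0 := by
    intro hf0
    have := congrArg (fun g => Polynomial.coeff g m₀) hf0
    simp [hf, Polynomial.coeff_monomial, hm₀, hd₀] at this
  set W : Finset B := Z.attach.image fun z => ⟨z.1, hZB z.1 z.2⟩ with hW
  have hWcard : W.card = Z.card := by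
    rw [hW, Finset.card_image_of_injective, Finset.card_attach]
    intro x y hxy
    exact Subtype.ext (congrArg (fun w : B => (w : K)) hxy)
  have hWZ : ∀ w ∈ W, (w : K) ∈ Z := by
    intro w hw
    obtain ⟨z, -, rfl⟩ := Finset.mem_image.mp hw
    exact z.2
  have hdvd : (W.val.map fun w => Polynomial.X - Polynomial.C w).prod ∣ f := by
    rw [Multiset.prod_X_sub_C_dvd_iff_le_roots hf₀, Finset.val_le_iff_val_subset]
    intro w hw
    rw [Polynomial.mem_roots hf₀, Polynomial.IsRoot, hf, Polynomial.eval_finsetSum]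
    apply Subtype.ext
    have := h w (hWZ w hw)
    push_cast
    simp only [Polynomial.eval_monomial]
    calc ∑ m ∈ S, ((d m * w ^ m : B) : K) = ∑ m ∈ S, (c m * (w : K) ^ m) / c m₀ := by
          refine Finset.sum_congr rfl fun m hm => ?_
          push_cast
          rw [hdval m hm]
          ring
      _ = 0 := by rw [← Finset.sum_div, this, zero_div]
  have hres : ∀ w ∈ W, IsLocalRing.residue B w = 1 := by
    intro w hw
    have hw1 : w ^ p ^ k = 1 := Subtype.ext (by simpa using hZ w (hWZ w hw))
    replace hw1 := congrArg (IsLocalRing.residue B) hw1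
    rw [map_pow, map_one] at hw1
    have : ExpChar (IsLocalRing.ResidueField B) p := .prime Fact.out
    rwa [← mul_one (p ^ k), ExpChar.pow_prime_pow_mul_eq_one_iff, pow_one] at hw1
  have hdvd' := Polynomial.map_dvd (IsLocalRing.residue B) hdvd
  rw [Polynomial.map_multiset_prod, Multiset.map_map, Multiset.map_congr rfl
    (g := fun _ => (Polynomial.X - 1)) (fun w hw => by simp [hres w hw]), Multiset.map_const',
    Multiset.prod_replicate, hf, Polynomial.map_sum] at hdvd'
  simp only [Polynomial.map_monomial] at hdvd'
  have := coeff_eq_zero_of_X_sub_one_pow_dvd S hS hbal _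
    ((pow_dvd_pow _ (by rw [← hWcard] at hcard; exact hcard)).trans hdvd') m₀ hm₀
  rw [hd₀, map_one] at this
  exact one_ne_zero this

theorem dftMatrix_apply_eq_stdAddChar (N : ℕ) [NeZero N] (m n : ZMod N) :
    dftMatrix N m n = ZMod.stdAddChar (-(m * n)) := by
  have : -(m * n) = ((-(m.val * n.val : ℤ) : ℤ) : ZMod N) := by
    push_cast
    simp
  rw [this, ZMod.stdAddChar_coe, dftMatrix, Matrix.of_apply]
  congr 1
  push_cast
  ring

theorem dftMatrix_apply_eq_pow (N : ℕ) [NeZero N] (m n : ZMod N) :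
    dftMatrix N m n = ZMod.stdAddChar (-n) ^ m.val := by
  rw [dftMatrix_apply_eq_stdAddChar, ← AddChar.map_nsmul_eq_pow]
  simp

theorem Nat.add_sub_one_div_le_div_add_one {d : ℕ} (hd : 0 < d) (n : ℕ) :
    (n + d - 1) / d ≤ n / d + 1 := by
  rw [← Nat.add_div_right _ hd]
  exact Nat.div_le_div_right (by omega)

theorem UniformlyDistributed.card_filter_le_card_filter_add_one {N d : ℕ} [NeZero N]
    {ℳ : Finset (ZMod N)} (h : UniformlyDistributed N ℳ) (hd : d ∣ N) {a b : ℕ} (ha : a < d)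
    (hb : b < d) :
    (ℳ.filter fun m => m.val % d = a).card ≤ (ℳ.filter fun m => m.val % d = b).card + 1 := by
  have hceil := Nat.add_sub_one_div_le_div_add_one (Nat.zero_lt_of_lt ha) ℳ.card
  have hfloor : ℳ.card / d ≤ (ℳ.card + d - 1) / d := Nat.div_le_div_right (by omega)
  have := h d hd (by omega) a ha
  have := h d hd (by omega) b hb
  omega

theorem UniformlyDistributed.dftFullSparkRows {p k : ℕ} (hp : p.Prime) [NeZero (p ^ k)]
    {ℳ : Finset (ZMod (p ^ k))} (h : UniformlyDistributed (p ^ k) ℳ) :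
    DFTFullSparkRows (p ^ k) ℳ := by
  classical
  have : Fact p.Prime := ⟨hp⟩
  intro g hg hdet
  obtain ⟨v, hv₀, hv⟩ := Matrix.exists_vecMul_eq_zero_iff.mpr hdet
  refine hv₀ (funext fun i => ?_)
  have hval := ZMod.val_injective (p ^ k)
  have hcard : ∀ e a, ((ℳ.image ZMod.val).filter fun m => m % p ^ e = a).card =
      (ℳ.filter fun m => m.val % p ^ e = a).card := fun e a => by
    rw [Finset.filter_image, Finset.card_image_of_injective _ hval]
  set c : ℕ → ℂ := fun m => if hm : (m : ZMod (p ^ k)) ∈ ℳ then v ⟨m, hm⟩ else 0 with hc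
  set z : {m : ZMod (p ^ k) // m ∈ ℳ} → ℂ := fun j => ZMod.stdAddChar (-(g j)) with hz
  have hzinj : Function.Injective z :=
    ZMod.injective_stdAddChar.comp (neg_injective.comp hg)
  have := eq_zero_of_sum_mul_pow_eq_zero (p := p) (k := k) (ℳ.image ZMod.val)
    (by
      intro m hm
      obtain ⟨x, -, rfl⟩ := Finset.mem_image.mp hm
      exact ZMod.val_lt x)
    (by
      intro e he a ha b hb
      rw [hcard, hcard]
      exact h.card_filter_le_card_filter_add_one (pow_dvd_pow p he) ha hb)
    (Finset.univ.image z)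
    (by
      intro w hw
      obtain ⟨j, -, rfl⟩ := Finset.mem_image.mp hw
      rw [hz, ← AddChar.map_nsmul_eq_pow]
      simp only [nsmul_eq_mul, ZMod.natCast_self, zero_mul, AddChar.map_zero_eq_one])
    (by
      rw [Finset.card_image_of_injective _ hval, Finset.card_image_of_injective _ hzinj]
      simp)
    c
    (by
      intro w hw
      obtain ⟨j, -, rfl⟩ := Finset.mem_image.mp hw
      rw [Finset.sum_image fun x _ y _ hxy => hval hxy, ← Finset.sum_coe_sort]
      refine Eq.trans (Finset.sum_congr rfl fun m _ => ?_) (congrFun hv j)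
      change _ = v m * dftMatrix (p ^ k) m (g j)
      rw [dftMatrix_apply_eq_pow]
      simp [hc, hz])
    (i : ZMod (p ^ k)).val (Finset.mem_image_of_mem _ i.2)
  simpa [hc] using this

theorem sum_range_mul_mod {M : Type*} [Semiring M] (F : ℕ → M) (d L : ℕ) :
    ∑ n ∈ Finset.range (d * L), F (n % L) = d * ∑ t ∈ Finset.range L, F t := by
  induction d with
  | zero => simp
  | succ d ih =>
    rw [Nat.succ_mul, Finset.sum_range_add, ih, Nat.cast_succ, add_one_mul]
    congr 1
    refine Finset.sum_congr rfl fun t ht => ?_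
    rw [Nat.mul_add_mod', Nat.mod_eq_of_lt (Finset.mem_range.mp ht)]

theorem ZMod.sum_val_eq_sum_range {M : Type*} [AddCommMonoid M] (N : ℕ) [NeZero N] (F : ℕ → M) :
    ∑ n : ZMod N, F n.val = ∑ n ∈ Finset.range N, F n :=
  Finset.sum_nbij ZMod.val (fun n _ => Finset.mem_range.mpr n.val_lt)
    (fun _ _ _ _ h => ZMod.val_injective N h)
    (fun n hn => ⟨n, by simp, ZMod.val_cast_of_lt (by simpa using hn)⟩) (fun _ _ => rfl)

theorem ZMod.sum_val_mod_eq {M : Type*} [Semiring M] {N d L : ℕ} [NeZero N] (hN : N = d * L)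
    (F : ℕ → M) : ∑ n : ZMod N, F (n.val % L) = d * ∑ t ∈ Finset.range L, F t := by
  rw [ZMod.sum_val_eq_sum_range N fun n => F (n % L), ← sum_range_mul_mod, hN]

theorem ZMod.card_filter_val_mod_lt {N d L s : ℕ} [NeZero N] (hN : N = d * L) (hs : s ≤ L) :
    (Finset.univ.filter fun n : ZMod N => n.val % L < s).card = d * s := by
  rw [Finset.card_filter, ZMod.sum_val_mod_eq hN fun t => if t < s then 1 else 0,
    ← Finset.card_filter]
  congr
  rw [show (Finset.range L).filter (· < s) = Finset.range s by ext x; simp; omega,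
    Finset.card_range]

theorem ZMod.sub_natCast_mul_eq {N d L a : ℕ} [NeZero N] (hN : N = d * L) {m : ZMod N}
    (hm : m.val % d = a) (n : ZMod N) :
    (m - a) * n = (m - a) * ((n.val % L : ℕ) : ZMod N) := by
  have h₁ : m - a = (d : ZMod N) * (m.val / d : ℕ) := by
    rw [sub_eq_iff_eq_add]
    conv_lhs => rw [← ZMod.natCast_zmod_val m, ← Nat.div_add_mod m.val d, hm]
    push_cast
    rfl
  have h₂ : n = (L : ZMod N) * (n.val / L : ℕ) + (n.val % L : ℕ) := by
    conv_lhs => rw [← ZMod.natCast_zmod_val n, ← Nat.div_add_mod n.val L]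
    push_cast
    rfl
  have h₃ : (d : ZMod N) * L = 0 := by
    rw [← Nat.cast_mul, ← hN, ZMod.natCast_self]
  conv_lhs => rw [h₂]
  rw [h₁]
  linear_combination ((m.val / d : ℕ) : ZMod N) * (n.val / L : ℕ) * h₃

theorem ZMod.val_mod_eq_of_sub_mul_eq_zero {N d L a : ℕ} [NeZero N] (hN : N = d * L)
    (ha : a < d) {m : ZMod N} (h : (m - a) * (L : ZMod N) = 0) : m.val % d = a := by
  have hL : L ≠ 0 := by
    rintro rfl
    exact NeZero.ne N (by simpa using hN)
  have h₁ : ((m.val * L : ℕ) : ZMod N) = ((a * L : ℕ) : ZMod N) := by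
    push_cast
    rw [ZMod.natCast_zmod_val]
    linear_combination h
  rw [ZMod.natCast_eq_natCast_iff] at h₁
  have := Nat.ModEq.mul_right_cancel' hL (h₁.of_dvd (dvd_of_eq hN.symm))
  rwa [Nat.ModEq, Nat.mod_eq_of_lt ha] at this

theorem DFTFullSparkRows.eq_zero_of_sum_eq_zero {N : ℕ} [NeZero N] {S : Finset (ZMod N)}
    (h : DFTFullSparkRows N S) {T : Finset (ZMod N)} (hT : T.card ≤ S.card) (v : ZMod N → ℂ)
    (hvT : ∀ n ∉ T, v n = 0) (hv : ∀ m ∈ S, ∑ n, dftMatrix N m n * v n = 0) : v = 0 := by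
  classical
  obtain ⟨T', hTT', -, hT'⟩ := Finset.exists_subsuperset_card_eq (Finset.subset_univ T) hT
    (Finset.card_le_univ S)
  let g := Finset.equivOfCardEq hT'.symm
  by_contra hne
  refine h (fun j => g j) (Subtype.val_injective.comp g.injective) ?_
  refine Matrix.exists_mulVec_eq_zero_iff.mp ⟨fun j => v (g j), fun h₀ => hne ?_, ?_⟩
  · funext n
    by_cases hn : n ∈ T'
    · simpa using congrFun h₀ (g.symm ⟨n, hn⟩)
    · exact hvT n fun hn' => hn (hTT' hn')
  · funext i
    refine Eq.trans ?_ (hv i i.2)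
    calc _ = ∑ j, dftMatrix N i (g j) * v (g j) := rfl
      _ = ∑ n : T', dftMatrix N i n * v n :=
        g.sum_comp fun n : T' => dftMatrix N i n * v n
      _ = ∑ n ∈ T', dftMatrix N i n * v n :=
        Finset.sum_coe_sort T' fun n => dftMatrix N i n * v n
      _ = _ := Finset.sum_subset (Finset.subset_univ _) fun n _ hn => by
        rw [hvT n fun hn' => hn (hTT' hn'), mul_zero]

theorem DFTFullSparkRows.eq_zero_of_forall_sum_mul_eq_zero {N : ℕ} [NeZero N]
    {S : Finset (ZMod N)} (h : DFTFullSparkRows N S) {T : Finset (ZMod N)}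
    (hT : S.card ≤ T.card) (c : ZMod N → ℂ)
    (hc : ∀ n ∈ T, ∑ m ∈ S, c m * dftMatrix N m n = 0) : ∀ m ∈ S, c m = 0 := by
  classical
  obtain ⟨T', hT'T, hT'⟩ := Finset.exists_subset_card_eq hT
  let g := Finset.equivOfCardEq hT'.symm
  by_contra! hne
  obtain ⟨m, hm, hcm⟩ := hne
  refine h (fun j => g j) (Subtype.val_injective.comp g.injective) ?_
  refine Matrix.exists_vecMul_eq_zero_iff.mp
    ⟨fun j => c j, fun h₀ => hcm (congrFun h₀ ⟨m, hm⟩), funext fun j => ?_⟩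
  refine Eq.trans ?_ (hc (g j) (hT'T (g j).2))
  exact Finset.sum_coe_sort S fun m => c m * dftMatrix N m (g j)

theorem exists_ne_zero_forall_sum_mul_eq_zero {K ι κ : Type*} [Field K] (s : Finset ι)
    (t : Finset κ) (hst : t.card < s.card) (A : κ → ι → K) :
    ∃ c : ι → K, (∀ i ∉ s, c i = 0) ∧ (∃ i ∈ s, c i ≠ 0) ∧
      ∀ j ∈ t, ∑ i ∈ s, A j i * c i = 0 := by
  classical
  have hker := LinearMap.ker_ne_bot_of_finrank_lt
    (f := Matrix.mulVecLin (Matrix.of fun (j : t) (i : s) => A j i)) (by simpa using hst)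
  obtain ⟨x, hx, hx₀⟩ := (Submodule.ne_bot_iff _).mp hker
  obtain ⟨i, hi⟩ := Function.ne_iff.mp hx₀
  refine ⟨fun i => if hi : i ∈ s then x ⟨i, hi⟩ else 0, fun i hi => by simp [hi],
    ⟨i, i.2, by simpa using hi⟩, fun j hj => ?_⟩
  rw [← Finset.sum_coe_sort]
  refine Eq.trans (Finset.sum_congr rfl fun i _ => ?_) (congrFun hx ⟨j, hj⟩)
  simp

theorem DFTFullSparkRows.div_le_card_filter {N d L a : ℕ} [NeZero N] (hN : N = d * L)
    (ha : a < d) {S : Finset (ZMod N)} (h : DFTFullSparkRows N S) :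
    S.card / d ≤ (S.filter fun m => m.val % d = a).card := by
  by_contra! hlt
  have hsL : S.card / d ≤ L := Nat.div_le_of_le_mul (by
    rw [← hN]
    simpa using Finset.card_le_univ S)
  obtain ⟨c, hc₀, ⟨t, ht, hct⟩, hc⟩ := exists_ne_zero_forall_sum_mul_eq_zero
    (Finset.range (S.card / d)) (S.filter fun m => m.val % d = a) (by simpa using hlt)
    (fun (m : ZMod N) t => (ZMod.stdAddChar (-((m - (a : ZMod N)) * (t : ZMod N))) : ℂ))
  have htL : t < L := (Finset.mem_range.mp ht).trans_le hsL
  have hLN : L ∣ N := hN ▸ dvd_mul_left L d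
  have htN : t < N := htL.trans_le (Nat.le_of_dvd (Nat.pos_of_neZero N) hLN)
  have hterm : ∀ m n : ZMod N,
      dftMatrix N m n * (c (n.val % L) * ZMod.stdAddChar ((a : ZMod N) * n)) =
        ZMod.stdAddChar (-((m - (a : ZMod N)) * n)) * c (n.val % L) := by
    intro m n
    rw [dftMatrix_apply_eq_stdAddChar, show -((m - (a : ZMod N)) * n) = -(m * n) + a * n by ring,
      AddChar.map_add_eq_mul]
    ring
  have hv := h.eq_zero_of_sum_eq_zero
    (T := Finset.univ.filter fun n : ZMod N => n.val % L < S.card / d)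
    (by rw [ZMod.card_filter_val_mod_lt hN hsL]; exact Nat.mul_div_le _ _)
    (fun n => c (n.val % L) * ZMod.stdAddChar ((a : ZMod N) * n))
    (fun n hn => by
      have hn' : n.val % L ∉ Finset.range (S.card / d) := by simpa using hn
      simp only [hc₀ _ hn', zero_mul])
    (fun m hm => by
      simp only [hterm]
      by_cases hma : m.val % d = a
      · rw [Finset.sum_congr rfl fun n _ => by rw [ZMod.sub_natCast_mul_eq hN hma n],
          ZMod.sum_val_mod_eq hN
          fun t => ZMod.stdAddChar (-((m - (a : ZMod N)) * (t : ZMod N))) * c t,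
          ← Finset.sum_subset (Finset.range_subset_range.mpr hsL)
            (fun t _ ht => by rw [hc₀ t ht, mul_zero]),
          hc m (Finset.mem_filter.mpr ⟨hm, hma⟩), mul_zero]
      · set X := ∑ n : ZMod N, ZMod.stdAddChar (-((m - (a : ZMod N)) * n)) * c (n.val % L) with hX
        have hshift : X = ZMod.stdAddChar (-((m - (a : ZMod N)) * (L : ZMod N))) * X := by
          conv_lhs => rw [hX, ← Equiv.sum_comp (Equiv.addRight (L : ZMod N))]
          rw [hX, Finset.mul_sum]
          refine Finset.sum_congr rfl fun n _ => ?_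
          rw [Equiv.coe_addRight, mul_add, neg_add, AddChar.map_add_eq_mul, ZMod.val_add,
            ZMod.val_natCast, Nat.add_mod_mod, Nat.mod_mod_of_dvd _ hLN, Nat.add_mod_right]
          ring
        by_contra hX₀
        have he : (ZMod.stdAddChar (-((m - (a : ZMod N)) * (L : ZMod N))) : ℂ) = 1 :=
          mul_right_cancel₀ hX₀ (by rw [one_mul, ← hshift])
        rw [← AddChar.map_zero_eq_one (ZMod.stdAddChar (N := N)),
          ZMod.injective_stdAddChar.eq_iff, neg_eq_zero] at he
        exact hma (ZMod.val_mod_eq_of_sub_mul_eq_zero hN ha he))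
  have hvt := congrFun hv (t : ZMod N)
  rw [ZMod.val_cast_of_lt htN, Nat.mod_eq_of_lt htL] at hvt
  exact (mul_ne_zero hct ((AddChar.val_isUnit _ _).ne_zero)) hvt

theorem DFTFullSparkRows.card_filter_le_div {N d L a : ℕ} [NeZero N] (hN : N = d * L)
    (ha : a < d) {S : Finset (ZMod N)} (h : DFTFullSparkRows N S) :
    (S.filter fun m => m.val % d = a).card ≤ (S.card + d - 1) / d := by
  by_contra! hlt
  have hd : 0 < d := by omega
  have hSN : S.card ≤ d * L := by
    rw [← hN]
    simpa using Finset.card_le_univ S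
  have hsL : (S.card + d - 1) / d ≤ L := by
    rw [← Nat.lt_succ_iff, Nat.div_lt_iff_lt_mul hd, Nat.succ_mul, mul_comm L]
    omega
  have hS : S.card ≤ d * ((S.card + d - 1) / d) := by
    have := Nat.div_add_mod (S.card + d - 1) d
    have := Nat.mod_lt (S.card + d - 1) hd
    omega
  obtain ⟨c, hc₀, ⟨m, hm, hcm⟩, hc⟩ := exists_ne_zero_forall_sum_mul_eq_zero
    (S.filter fun m => m.val % d = a) (Finset.range ((S.card + d - 1) / d)) (by simpa using hlt)
    (fun t (m : ZMod N) => (ZMod.stdAddChar (-((m - (a : ZMod N)) * (t : ZMod N))) : ℂ))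
  refine hcm (h.eq_zero_of_forall_sum_mul_eq_zero
    (T := Finset.univ.filter fun n : ZMod N => n.val % L < (S.card + d - 1) / d)
    (by rwa [ZMod.card_filter_val_mod_lt hN hsL]) c (fun n hn => ?_) m
    (Finset.mem_filter.mp hm).1)
  have := hc (n.val % L) (by simpa using hn)
  rw [← Finset.sum_subset (Finset.filter_subset (fun m => m.val % d = a) S)
    (fun m _ hm => by rw [hc₀ m hm, zero_mul])]
  rw [← mul_zero (ZMod.stdAddChar (-((a : ZMod N) * n)) : ℂ), ← this, Finset.mul_sum]
  refine Finset.sum_congr rfl fun m hm => ?_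
  rw [← ZMod.sub_natCast_mul_eq hN (Finset.mem_filter.mp hm).2, dftMatrix_apply_eq_stdAddChar,
    ← mul_assoc, ← AddChar.map_add_eq_mul, mul_comm (c m)]
  congr 2
  ring

/-- Full spark forces uniform distribution for every `N`, not only for prime powers. -/
theorem DFTFullSparkRows.uniformlyDistributed {N : ℕ} [NeZero N] {S : Finset (ZMod N)}
    (h : DFTFullSparkRows N S) : UniformlyDistributed N S := by
  rintro d ⟨L, hN⟩ hd a ha
  have hlow := h.div_le_card_filter hN ha
  have hup := h.card_filter_le_div hN ha
  have hceil := Nat.add_sub_one_div_le_div_add_one hd S.card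
  omega

/-- For `N` a prime power, the rows of the `N × N` DFT indexed by
`ℳ ⊆ ℤ_N` form a full spark matrix if and only if `ℳ` is uniformly distributed
over the divisors of `N`. -/
theorem stmt_8 (N : ℕ) [NeZero N] (hN : ∃ p k : ℕ, p.Prime ∧ N = p ^ k)
    (ℳ : Finset (ZMod N)) :
    DFTFullSparkRows N ℳ ↔ UniformlyDistributed N ℳ := by
  obtain ⟨p, k, hp, rfl⟩ := hN
  exact ⟨DFTFullSparkRows.uniformlyDistributed, UniformlyDistributed.dftFullSparkRows hp⟩
end

section
/- Every real M×N matrix with unit-norm columns has worst-case coherence μ ≥ cos(π·((M−1)·Γ((M−1)/2)/(N·π^{1/2}·Γ(M/2)))^{1/(M−1)}). -/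
open MeasureTheory Set InnerProductGeometry

lemma lintegral_fun_norm_eq {E : Type*} [NormedAddCommGroup E] [NormedSpace ℝ E]
    [MeasurableSpace E] [Nontrivial E] (μ : Measure E) [FiniteDimensional ℝ E] [BorelSpace E]
    [μ.IsAddHaarMeasure] {f : ℝ → ℝ} (hf : ∀ r, 0 ≤ f r) (hint : Integrable (fun x : E ↦ f ‖x‖) μ) :
    ∫⁻ x : E, ENNReal.ofReal (f ‖x‖) ∂μ =
      ENNReal.ofReal (Module.finrank ℝ E * μ.real (Metric.ball 0 1)) *
        ∫⁻ y in Ioi (0 : ℝ), ENNReal.ofReal (y ^ (Module.finrank ℝ E - 1) * f y) := by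
  rw [← ofReal_integral_eq_lintegral_ofReal hint (ae_of_all _ fun x ↦ hf _),
    integral_fun_norm_addHaar, nsmul_eq_mul, smul_eq_mul, ← mul_assoc,
    ENNReal.ofReal_mul (by positivity)]
  simp only [smul_eq_mul]
  rw [ofReal_integral_eq_lintegral_ofReal
    (by simpa [IntegrableOn] using (integrable_fun_norm_addHaar μ).1 hint)]
  filter_upwards [ae_restrict_mem measurableSet_Ioi] with y hy
  exact mul_nonneg (pow_nonneg (le_of_lt hy) _) (hf y)

lemma angle_lt_of_norm_lt_tan {F : Type*} [NormedAddCommGroup F] [InnerProductSpace ℝ F]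
    {θ t : ℝ} {y : F} (hθ : 0 < θ) (hθ' : θ < Real.pi / 2) (ht : 0 < t)
    (hy : ‖y‖ < t * Real.tan θ) :
    angle (WithLp.toLp 2 (t, y)) (WithLp.toLp 2 ((1 : ℝ), (0 : F))) < θ := by
  have hcos : 0 < Real.cos θ := Real.cos_pos_of_mem_Ioo ⟨by linarith, hθ'⟩
  by_contra! h
  have h1 := Real.cos_le_cos_of_nonneg_of_le_pi hθ.le (angle_le_pi _ _) h
  have h2 := cos_angle_mul_norm_mul_norm
    (WithLp.toLp 2 (t, y)) (WithLp.toLp 2 ((1 : ℝ), (0 : F)))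
  have h3 := WithLp.prod_norm_sq_eq_of_L2 (WithLp.toLp 2 (t, y))
  have h4 : ‖WithLp.toLp 2 ((1 : ℝ), (0 : F))‖ = 1 := by simp
  have h5 := norm_nonneg (WithLp.toLp 2 (t, y))
  simp only [WithLp.prod_inner_apply, h4] at h2
  simp at h2 h3
  rw [Real.tan_eq_sin_div_cos, ← mul_div_assoc, lt_div_iff₀ hcos] at hy
  have h6 : (‖y‖ * Real.cos θ) ^ 2 < (t * Real.sin θ) ^ 2 := by gcongr
  have h7 : t ^ 2 ≤ (‖WithLp.toLp 2 (t, y)‖ * Real.cos θ) ^ 2 := by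
    refine pow_le_pow_left₀ ht.le ?_ 2
    calc t = _ := h2.symm
      _ ≤ _ := by rw [mul_comm]; gcongr
  rw [mul_pow, h3] at h7
  nlinarith [Real.sin_sq_add_cos_sq θ]

lemma lintegral_sector {n : ℕ} {θ : ℝ} (hn : 1 ≤ n) (hθ : 0 < θ) (hθ' : θ < Real.pi / 2) :
    ENNReal.ofReal (Real.Gamma (((n : ℝ) + 1) / 2) / 2 * ((2 / Real.pi) ^ (n - 1) * (θ ^ n / n))) ≤
      ∫⁻ p : ℝ × ℝ, {p : ℝ × ℝ | 0 < p.1 ∧ 0 < p.2 ∧ p.2 < p.1 * Real.tan θ}.indicator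
        (fun p ↦ ENNReal.ofReal (p.2 ^ (n - 1) * Real.exp (-(p.1 ^ 2 + p.2 ^ 2)))) p := by
  have hpi := Real.pi_pos
  have hr : ENNReal.ofReal (Real.Gamma (((n : ℝ) + 1) / 2) / 2) =
      ∫⁻ r in Ioi (0 : ℝ), ENNReal.ofReal (r ^ n * Real.exp (-r ^ 2)) := by
    have h := integral_rpow_mul_exp_neg_rpow (p := 2) (q := n) (by norm_num)
      (by have : (0 : ℝ) ≤ n := by positivity
          linarith)
    have hc : ∀ r : ℝ, r ^ (n : ℝ) * Real.exp (-r ^ (2 : ℝ)) = r ^ n * Real.exp (-r ^ 2) := by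
      intro r
      rw [Real.rpow_natCast, ← Real.rpow_natCast r 2]
      norm_num
    simp only [hc] at h
    rw [← ofReal_integral_eq_lintegral_ofReal, h]
    · congr 1; ring
    · by_contra hni
      rw [integral_undef hni] at h
      have : 0 < Real.Gamma (((n : ℝ) + 1) / 2) := Real.Gamma_pos_of_pos (by positivity)
      linarith
    · filter_upwards [ae_restrict_mem measurableSet_Ioi] with r hr
      have : (0 : ℝ) < r := hr
      simp only [Pi.zero_apply]; positivity
  have hφ : ENNReal.ofReal ((2 / Real.pi) ^ (n - 1) * (θ ^ n / n)) =
      ∫⁻ φ in Ioo 0 θ, ENNReal.ofReal ((2 / Real.pi * φ) ^ (n - 1)) := by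
    rw [← ofReal_integral_eq_lintegral_ofReal, ← integral_Ioc_eq_integral_Ioo,
      ← intervalIntegral.integral_of_le hθ.le]
    · simp only [mul_pow, intervalIntegral.integral_const_mul, integral_pow]
      obtain ⟨m, rfl⟩ : ∃ m, n = m + 1 := ⟨n - 1, by omega⟩
      simp
    · exact (Continuous.integrableOn_Icc (by fun_prop)).mono_set Ioo_subset_Icc_self
    · filter_upwards [ae_restrict_mem measurableSet_Ioo] with φ hφ
      have : (0 : ℝ) < φ := hφ.1
      simp only [Pi.zero_apply]; positivity
  rw [ENNReal.ofReal_mul (by have := Real.Gamma_pos_of_pos (s := ((n : ℝ) + 1) / 2) (by positivity)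
                             positivity), hr, hφ,
    ← lintegral_prod_mul (by fun_prop) (by fun_prop), Measure.prod_restrict,
    ← lintegral_comp_polarCoord_symm, polarCoord_target]
  refine le_trans (setLIntegral_mono_ae' (measurableSet_Ioi.prod measurableSet_Ioo) ?_)
    (lintegral_mono_set (prod_mono le_rfl (Ioo_subset_Ioo (by linarith) (by linarith))))
  refine ae_of_all _ ?_
  rintro ⟨r, φ⟩ ⟨hr0, hφ0, hφ1⟩
  simp only [mem_Ioi] at hr0 hφ0 hφ1
  have hs : 0 < Real.sin φ := Real.sin_pos_of_pos_of_lt_pi hφ0 (by linarith)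
  have hc : 0 < Real.cos φ := Real.cos_pos_of_mem_Ioo ⟨by linarith, by linarith⟩
  have hlt : Real.sin φ < Real.cos φ * Real.tan θ := by
    have := Real.tan_lt_tan_of_nonneg_of_lt_pi_div_two hφ0.le hθ' hφ1
    rw [Real.tan_eq_sin_div_cos φ, div_lt_iff₀ hc] at this
    linarith
  rw [indicator_of_mem, smul_eq_mul, ← ENNReal.ofReal_mul (by positivity),
    ← ENNReal.ofReal_mul (by positivity)]
  · refine ENNReal.ofReal_le_ofReal ?_
    simp only [polarCoord_symm_apply]
    have e1 : (r * Real.cos φ) ^ 2 + (r * Real.sin φ) ^ 2 = r ^ 2 := by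
      linear_combination r ^ 2 * Real.sin_sq_add_cos_sq φ
    have e2 : r ^ n = r * r ^ (n - 1) := by rw [← pow_succ']; congr 1; omega
    rw [e1, e2, mul_pow r]
    have := pow_le_pow_left₀ (by positivity) (Real.mul_le_sin hφ0.le (by linarith)) (n - 1)
    calc _ = r * r ^ (n - 1) * Real.exp (-r ^ 2) * (2 / Real.pi * φ) ^ (n - 1) := by ring
      _ ≤ r * r ^ (n - 1) * Real.exp (-r ^ 2) * Real.sin φ ^ (n - 1) := by gcongr
      _ = _ := by ring
  · simp only [polarCoord_symm_apply, mem_ofPred_eq]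
    refine ⟨by positivity, by positivity, ?_⟩
    rw [mul_assoc]; gcongr

lemma measurableSet_angle_lt {E : Type*} [NormedAddCommGroup E] [InnerProductSpace ℝ E]
    [MeasurableSpace E] [BorelSpace E] [FiniteDimensional ℝ E] (u : E) (θ : ℝ) :
    MeasurableSet {x : E | angle x u < θ} := by
  refine measurableSet_lt ?_ measurable_const
  unfold angle
  exact Real.continuous_arccos.measurable.comp (by fun_prop)

lemma lintegral_cone_prod {F : Type*} [NormedAddCommGroup F] [InnerProductSpace ℝ F]
    [MeasurableSpace F] [BorelSpace F] [FiniteDimensional ℝ F] [Nontrivial F]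
    {θ : ℝ} (hθ : 0 < θ) (hθ' : θ < Real.pi / 2) {n : ℕ} (hn : Module.finrank ℝ F = n) :
    ENNReal.ofReal (n * volume.real (Metric.ball (0 : F) 1)) *
        ENNReal.ofReal (Real.Gamma (((n : ℝ) + 1) / 2) / 2 *
          ((2 / Real.pi) ^ (n - 1) * (θ ^ n / n))) ≤
      ∫⁻ x in {x | angle x (WithLp.toLp 2 ((1 : ℝ), (0 : F))) < θ},
        ENNReal.ofReal (Real.exp (-‖x‖ ^ 2)) := by
  have hn1 : 1 ≤ n := hn ▸ Module.finrank_pos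
  let H : ℝ → ℝ → ℝ := fun t s ↦
    if 0 < t ∧ s < t * Real.tan θ then Real.exp (-(t ^ 2 + s ^ 2)) else 0
  have hH0 : ∀ t s, 0 ≤ H t s := fun t s ↦ by
    simp only [H]; split_ifs <;> positivity
  have hHm : Measurable fun p : ℝ × ℝ ↦ H p.1 p.2 := by
    refine Measurable.ite ?_ (by fun_prop) measurable_const
    exact (measurableSet_lt measurable_const measurable_fst).inter
      (measurableSet_lt measurable_snd (by fun_prop))
  have hHint : ∀ t, Integrable (fun y : F ↦ H t ‖y‖) := by
    intro t
    by_cases ht : 0 < t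
    · have : (fun y : F ↦ H t ‖y‖) = (Metric.ball (0 : F) (t * Real.tan θ)).indicator
          fun y ↦ Real.exp (-(t ^ 2 + ‖y‖ ^ 2)) := by
        classical
        ext y
        simp [H, ht, indicator_apply]
      rw [this, integrable_indicator_iff measurableSet_ball]
      exact (Continuous.continuousOn (by fun_prop)).integrableOn_compact
        (isCompact_closedBall (0 : F) (t * Real.tan θ)) |>.mono_set Metric.ball_subset_closedBall
    · simp [H, ht]
  rw [← (WithLp.volume_preserving_toLp ℝ F).setLIntegral_comp_preimage
    (measurableSet_angle_lt _ _) (by fun_prop)]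
  calc
    _ ≤ ENNReal.ofReal (n * volume.real (Metric.ball (0 : F) 1)) * ∫⁻ p : ℝ × ℝ,
          (Ioi 0).indicator (fun s ↦ ENNReal.ofReal (s ^ (n - 1) * H p.1 s)) p.2 := by
      gcongr
      refine (lintegral_sector hn1 hθ hθ').trans (lintegral_mono fun p ↦ ?_)
      by_cases hp : 0 < p.1 ∧ 0 < p.2 ∧ p.2 < p.1 * Real.tan θ
      · rw [indicator_of_mem (by exact hp), indicator_of_mem (by exact hp.2.1)]
        simp [H, hp.1, hp.2.2]
      · rw [indicator_of_notMem (by exact hp)]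
        exact zero_le
    _ = ∫⁻ t, ∫⁻ y : F, ENNReal.ofReal (H t ‖y‖) := by
      have hm : Measurable fun p : ℝ × ℝ ↦
          (Ioi 0).indicator (fun s ↦ ENNReal.ofReal (s ^ (n - 1) * H p.1 s)) p.2 := by
        have : (fun p : ℝ × ℝ ↦
            (Ioi 0).indicator (fun s ↦ ENNReal.ofReal (s ^ (n - 1) * H p.1 s)) p.2) =
            (Prod.snd ⁻¹' Ioi (0 : ℝ)).indicator
              fun p : ℝ × ℝ ↦ ENNReal.ofReal (p.2 ^ (n - 1) * H p.1 p.2) := by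
          classical
          ext p
          simp [indicator_apply]
        rw [this]
        exact Measurable.indicator (by fun_prop) (measurable_snd measurableSet_Ioi)
      rw [Measure.volume_eq_prod, lintegral_prod _ hm.aemeasurable,
        ← lintegral_const_mul _ hm.lintegral_prod_right']
      refine lintegral_congr fun t ↦ ?_
      rw [lintegral_fun_norm_eq volume (hH0 t) (hHint t), hn]
      exact congrArg _ (lintegral_indicator measurableSet_Ioi _)
    _ = ∫⁻ p : ℝ × F, ENNReal.ofReal (H p.1 ‖p.2‖) := by
      rw [Measure.volume_eq_prod, lintegral_prod]
      exact (hHm.comp (measurable_fst.prodMk measurable_snd.norm)).ennreal_ofReal.aemeasurable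
    _ ≤ _ := by
      rw [← lintegral_indicator
        ((WithLp.volume_preserving_toLp ℝ F).measurable (measurableSet_angle_lt _ _))]
      refine lintegral_mono fun p ↦ ?_
      by_cases hp : 0 < p.1 ∧ ‖p.2‖ < p.1 * Real.tan θ
      · rw [indicator_of_mem (by exact angle_lt_of_norm_lt_tan hθ hθ' hp.1 hp.2)]
        simp [H, hp.1, hp.2, WithLp.prod_norm_sq_eq_of_L2]
      · simp [H, hp]

lemma lintegral_cone {E : Type*} [NormedAddCommGroup E] [InnerProductSpace ℝ E]
    [MeasurableSpace E] [BorelSpace E] [FiniteDimensional ℝ E] {n : ℕ} (hn : 1 ≤ n)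
    (hE : Module.finrank ℝ E = n + 1) {u : E} (hu : ‖u‖ = 1)
    {θ : ℝ} (hθ : 0 < θ) (hθ' : θ < Real.pi / 2) :
    ENNReal.ofReal (Real.sqrt Real.pi ^ n / Real.Gamma ((n : ℝ) / 2) *
        Real.Gamma (((n : ℝ) + 1) / 2) * ((2 / Real.pi) ^ (n - 1) * (θ ^ n / n))) ≤
      ∫⁻ x in {x | angle x u < θ}, ENNReal.ofReal (Real.exp (-‖x‖ ^ 2)) := by
  let F := EuclideanSpace ℝ (Fin n)
  have : NeZero n := ⟨by omega⟩
  let g : WithLp 2 (ℝ × F) ≃ₗᵢ[ℝ] E := (stdOrthonormalBasis ℝ _).equiv (stdOrthonormalBasis ℝ E) (finCongr (by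
    rw [hE, (WithLp.linearEquiv 2 ℝ (ℝ × F)).finrank_eq]
    simp [F, add_comm]))
  let e : WithLp 2 (ℝ × F) := WithLp.toLp 2 ((1 : ℝ), (0 : F))
  have he : ‖g e‖ = ‖u‖ := by simp [e, hu]
  let f : WithLp 2 (ℝ × F) ≃ₗᵢ[ℝ] E := g.trans (Submodule.reflection (ℝ ∙ (g e - u))ᗮ)
  have hf : f e = u := Submodule.reflection_sub he
  rw [← f.measurePreserving.setLIntegral_comp_preimage (measurableSet_angle_lt _ _) (by fun_prop)]
  have hset : f ⁻¹' {x | angle x u < θ} = {x | angle x e < θ} := by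
    ext x
    have := f.toLinearIsometry.angle_map x e
    simp only [LinearIsometryEquiv.coe_toLinearIsometry, hf] at this
    simp [this]
  rw [hset]
  simp only [LinearIsometryEquiv.norm_map]
  refine le_trans (le_of_eq ?_) (lintegral_cone_prod (F := F) hθ hθ' (n := n) (by simp [F]))
  have hG : Real.Gamma ((n : ℝ) / 2 + 1) = (n : ℝ) / 2 * Real.Gamma ((n : ℝ) / 2) :=
    Real.Gamma_add_one (by positivity)
  have hG0 : 0 < Real.Gamma ((n : ℝ) / 2) := Real.Gamma_pos_of_pos (by positivity)
  have hball : volume.real (Metric.ball (0 : F) 1) =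
      Real.sqrt Real.pi ^ n / ((n : ℝ) / 2 * Real.Gamma ((n : ℝ) / 2)) := by
    rw [measureReal_def, EuclideanSpace.volume_ball, Fintype.card_fin, hG, ENNReal.ofReal_one,
      one_pow, one_mul, ENNReal.toReal_ofReal (by positivity)]
  rw [← ENNReal.ofReal_mul (by positivity), hball]
  congr 1
  field_simp

lemma lintegral_exp_neg_norm_sq {E : Type*} [NormedAddCommGroup E] [InnerProductSpace ℝ E]
    [MeasurableSpace E] [BorelSpace E] [FiniteDimensional ℝ E] :
    ∫⁻ x : E, ENNReal.ofReal (Real.exp (-‖x‖ ^ 2)) =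
      ENNReal.ofReal (Real.sqrt Real.pi ^ Module.finrank ℝ E) := by
  have h := GaussianFourier.integral_rexp_neg_mul_sq_norm (V := E) (b := 1) one_pos
  have hc : Real.pi ^ ((Module.finrank ℝ E : ℝ) / 2) =
      Real.sqrt Real.pi ^ Module.finrank ℝ E := by
    rw [Real.sqrt_eq_rpow, ← Real.rpow_natCast, ← Real.rpow_mul Real.pi_pos.le]
    congr 1; ring
  simp only [neg_mul, one_mul, div_one, hc] at h
  rw [← h, ofReal_integral_eq_lintegral_ofReal]
  · by_contra hni
    rw [integral_undef hni] at h
    have := Real.pi_pos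
    have : 0 < Real.sqrt Real.pi ^ Module.finrank ℝ E := by positivity
    linarith
  · exact ae_of_all _ fun x ↦ (Real.exp_pos _).le

lemma card_mul_pow_le_of_two_mul_le_angle {E ι : Type*} [NormedAddCommGroup E]
    [InnerProductSpace ℝ E] [FiniteDimensional ℝ E] [Fintype ι] {n : ℕ} (hn : 1 ≤ n)
    (hE : Module.finrank ℝ E = n + 1) {u : ι → E} (hu : ∀ i, ‖u i‖ = 1)
    {θ : ℝ} (hθ : 0 < θ) (hθ' : θ < Real.pi / 2)
    (hangle : Pairwise fun i j ↦ 2 * θ ≤ angle (u i) (u j)) :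
    Fintype.card ι * (Real.Gamma (((n : ℝ) + 1) / 2) * ((2 / Real.pi) ^ (n - 1) * (θ ^ n / n))) ≤
      Real.sqrt Real.pi * Real.Gamma ((n : ℝ) / 2) := by
  borelize E
  have hpi := Real.pi_pos
  have hG0 : 0 < Real.Gamma ((n : ℝ) / 2) := Real.Gamma_pos_of_pos (by positivity)
  have hG1 : 0 < Real.Gamma (((n : ℝ) + 1) / 2) := Real.Gamma_pos_of_pos (by positivity)
  let C : ι → Set E := fun i ↦ {x | angle x (u i) < θ}
  have hdisj : Pairwise (Function.onFun Disjoint C) := by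
    intro i j hij
    refine Set.disjoint_left.2 fun x hi hj ↦ ?_
    simp only [C, mem_ofPred_eq] at hi hj
    have := angle_le_angle_add_angle (u i) x (u j)
    rw [angle_comm (u i) x] at this
    linarith [hangle hij]
  have key : ENNReal.ofReal (Fintype.card ι * (Real.sqrt Real.pi ^ n / Real.Gamma ((n : ℝ) / 2) *
        Real.Gamma (((n : ℝ) + 1) / 2) * ((2 / Real.pi) ^ (n - 1) * (θ ^ n / n)))) ≤
      ENNReal.ofReal (Real.sqrt Real.pi ^ (n + 1)) := by
    rw [← hE, ← lintegral_exp_neg_norm_sq (E := E)]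
    calc _ = ∑ i : ι, ENNReal.ofReal (Real.sqrt Real.pi ^ n / Real.Gamma ((n : ℝ) / 2) *
          Real.Gamma (((n : ℝ) + 1) / 2) * ((2 / Real.pi) ^ (n - 1) * (θ ^ n / n))) := by
          rw [ENNReal.ofReal_mul (by positivity)]
          simp
      _ ≤ ∑ i : ι, ∫⁻ x in C i, ENNReal.ofReal (Real.exp (-‖x‖ ^ 2)) :=
          Finset.sum_le_sum fun i _ ↦ lintegral_cone hn hE (hu i) hθ hθ'
      _ = ∫⁻ x in ⋃ i, C i, ENNReal.ofReal (Real.exp (-‖x‖ ^ 2)) := by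
          rw [lintegral_iUnion (fun i ↦ measurableSet_angle_lt _ _) hdisj, tsum_fintype]
      _ ≤ _ := setLIntegral_le_lintegral _ _
  rw [ENNReal.ofReal_le_ofReal_iff (by positivity), pow_succ] at key
  have hs : 0 < Real.sqrt Real.pi ^ n := by positivity
  refine le_of_mul_le_mul_left ?_ (div_pos hs hG0)
  calc _ = _ := by ring
    _ ≤ _ := key
    _ = _ := by field_simp

lemma Gamma_half_le_sqrt_pi_mul_Gamma (n : ℕ) :
    Real.Gamma (((n : ℝ) + 1) / 2) ≤ Real.sqrt Real.pi * Real.Gamma (((n : ℝ) + 2) / 2) := by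
  induction n using Nat.twoStepInduction with
  | zero => simp [-one_div, Real.Gamma_one_half_eq]
  | one =>
    have h : Real.Gamma (((1 : ℕ) + 2 : ℝ) / 2) = 1 / 2 * Real.sqrt Real.pi := by
      rw [← Real.Gamma_one_half_eq, ← Real.Gamma_add_one (by norm_num)]
      norm_num
    rw [h]
    have h1 : (((1 : ℕ) : ℝ) + 1) / 2 = 1 := by norm_num
    rw [h1, Real.Gamma_one]
    nlinarith [Real.mul_self_sqrt Real.pi_pos.le, Real.pi_gt_three]
  | more n ih _ =>
    have h1 : (((n + 2 : ℕ) : ℝ) + 1) / 2 = ((n : ℝ) + 1) / 2 + 1 := by push_cast; ring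
    have h2 : (((n + 2 : ℕ) : ℝ) + 2) / 2 = ((n : ℝ) + 2) / 2 + 1 := by push_cast; ring
    rw [h1, h2, Real.Gamma_add_one (by positivity), Real.Gamma_add_one (by positivity)]
    have := Real.Gamma_pos_of_pos (s := ((n : ℝ) + 1) / 2) (by positivity)
    calc _ ≤ ((n : ℝ) + 2) / 2 * Real.Gamma (((n : ℝ) + 1) / 2) := by gcongr; norm_num
      _ ≤ ((n : ℝ) + 2) / 2 * (Real.sqrt Real.pi * Real.Gamma (((n : ℝ) + 2) / 2)) := by gcongr
      _ = _ := by ring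

lemma le_pi_mul_rpow_of_card_mul_pow_le {n N : ℕ} (hn : 1 ≤ n) (hN : 1 ≤ N) {δ a b : ℝ}
    (hδ : 0 ≤ δ) (ha : 0 < a) (hb : 0 < b)
    (h : (2 * N) * (b * ((2 / Real.pi) ^ (n - 1) * ((δ / 2) ^ n / n))) ≤ Real.sqrt Real.pi * a) :
    δ ≤ Real.pi * (n * a / (N * Real.sqrt Real.pi * b)) ^ ((1 : ℝ) / n) := by
  have hpi := Real.pi_pos
  have hsq := Real.mul_self_sqrt hpi.le
  have hs : 0 < Real.sqrt Real.pi := by positivity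
  have hn0 : (0 : ℝ) < n := by positivity
  have hN0 : (0 : ℝ) < N := by positivity
  have hpow : (2 / Real.pi) ^ (n - 1) * (δ / 2) ^ n = (δ / Real.pi) ^ n * (Real.pi / 2) := by
    obtain ⟨m, rfl⟩ : ∃ m, n = m + 1 := ⟨n - 1, by omega⟩
    simp only [Nat.add_sub_cancel, div_pow, pow_succ]
    field_simp
  have hle : (δ / Real.pi) ^ n ≤ n * a / (N * Real.sqrt Real.pi * b) := by
    rw [le_div_iff₀ (by positivity)]
    refine le_of_mul_le_mul_left ?_ (div_pos hs hn0)
    calc Real.sqrt Real.pi / n * ((δ / Real.pi) ^ n * (N * Real.sqrt Real.pi * b))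
        = (Real.sqrt Real.pi * Real.sqrt Real.pi) * (δ / Real.pi) ^ n * N * b / n := by ring
      _ = (2 * N) * (b * (((δ / Real.pi) ^ n * (Real.pi / 2)) / n)) := by rw [hsq]; ring
      _ = (2 * N) * (b * ((2 / Real.pi) ^ (n - 1) * ((δ / 2) ^ n / n))) := by
        rw [← hpow]; ring
      _ ≤ _ := h
      _ = _ := by field_simp
  have h2 := Real.rpow_le_rpow (by positivity) hle (z := (1 : ℝ) / n) (by positivity)
  rw [one_div, Real.pow_rpow_inv_natCast (by positivity) (by omega)] at h2
  rw [one_div]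
  calc δ = Real.pi * (δ / Real.pi) := by field_simp
    _ ≤ _ := by gcongr

lemma rpow_one_div_le_three_halves {n N : ℕ} (hn : 1 ≤ n) (hN : 2 ≤ N) :
    ((n * Real.Gamma ((n : ℝ) / 2)) /
      (N * Real.sqrt Real.pi * Real.Gamma (((n : ℝ) + 1) / 2))) ^ ((1 : ℝ) / n) ≤ 3 / 2 := by
  have hpi := Real.pi_pos
  have hn0 : (0 : ℝ) < n := by positivity
  have hN0 : (2 : ℝ) ≤ N := by exact_mod_cast hN
  have hG0 : 0 < Real.Gamma ((n : ℝ) / 2) := Real.Gamma_pos_of_pos (by positivity)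
  have hG1 : 0 < Real.Gamma (((n : ℝ) + 1) / 2) := Real.Gamma_pos_of_pos (by positivity)
  have hG : Real.Gamma ((n : ℝ) / 2) ≤ Real.sqrt Real.pi * Real.Gamma (((n : ℝ) + 1) / 2) := by
    obtain ⟨m, rfl⟩ : ∃ m, n = m + 1 := ⟨n - 1, by omega⟩
    convert Gamma_half_le_sqrt_pi_mul_Gamma m using 3 <;> push_cast <;> ring_nf
  have hber := one_add_mul_le_pow (a := (1 / 2 : ℝ)) (by norm_num) n
  have hle : (n * Real.Gamma ((n : ℝ) / 2)) /
      (N * Real.sqrt Real.pi * Real.Gamma (((n : ℝ) + 1) / 2)) ≤ (3 / 2 : ℝ) ^ n := by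
    rw [div_le_iff₀ (by positivity)]
    have h1 : (n : ℝ) ≤ (3 / 2 : ℝ) ^ n * N := by
      norm_num at hber
      nlinarith
    calc _ ≤ ((3 / 2 : ℝ) ^ n * N) * (Real.sqrt Real.pi * Real.Gamma (((n : ℝ) + 1) / 2)) := by
          gcongr
      _ = _ := by ring
  have h2 := Real.rpow_le_rpow (by positivity) hle (z := (1 : ℝ) / n) (by positivity)
  refine h2.trans (le_of_eq ?_)
  rw [one_div, Real.pow_rpow_inv_natCast (by norm_num) (by omega)]

lemma arccos_le_of_abs_inner_le {E : Type*} [NormedAddCommGroup E]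
    [InnerProductSpace ℝ E] [FiniteDimensional ℝ E] {n N : ℕ} (hn : 1 ≤ n) (hN : 1 ≤ N)
    (hE : Module.finrank ℝ E = n + 1) {u : Fin N → E} (hu : ∀ i, ‖u i‖ = 1) {μ : ℝ}
    (hμ0 : 0 ≤ μ) (hμ : ∀ i j, i ≠ j → |inner ℝ (u i) (u j)| ≤ μ) :
    Real.arccos μ ≤ Real.pi * ((n * Real.Gamma ((n : ℝ) / 2)) /
      (N * Real.sqrt Real.pi * Real.Gamma (((n : ℝ) + 1) / 2))) ^ ((1 : ℝ) / n) := by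
  have hpi := Real.pi_pos
  have hG0 : 0 < Real.Gamma ((n : ℝ) / 2) := Real.Gamma_pos_of_pos (by positivity)
  have hG1 : 0 < Real.Gamma (((n : ℝ) + 1) / 2) := Real.Gamma_pos_of_pos (by positivity)
  rcases (Real.arccos_nonneg μ).eq_or_lt with h0 | hpos
  · rw [← h0]; positivity
  refine le_pi_mul_rpow_of_card_mul_pow_le hn hN hpos.le hG0 hG1 ?_
  let v : Fin N × Bool → E := fun p ↦ if p.2 then u p.1 else -u p.1
  have hv : ∀ p, ‖v p‖ = 1 := by
    rintro ⟨i, _ | _⟩ <;> simp [v, hu]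
  have hle : Real.arccos μ ≤ Real.pi / 2 := Real.arccos_le_pi_div_two.2 hμ0
  have h := card_mul_pow_le_of_two_mul_le_angle hn hE hv (θ := Real.arccos μ / 2)
    (by positivity) (by linarith) ?_
  · simpa [mul_comm] using h
  · intro p q hpq
    simp only [angle, hv, mul_one, div_one]
    rw [mul_div_cancel₀ _ two_ne_zero]
    refine Real.arccos_le_arccos ?_
    obtain ⟨i, b⟩ := p
    obtain ⟨j, c⟩ := q
    by_cases hij : i = j
    · subst hij
      cases b <;> cases c <;> simp_all [v] <;> linarith
    · have := abs_le.1 (hμ i j hij)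
      cases b <;> cases c <;> simp [v] <;> linarith


/-- Every real `M × N` matrix with unit-norm columns has worst-case
coherence `μ ≥ cos(π·((M−1)·Γ((M−1)/2)/(N·√π·Γ(M/2)))^{1/(M−1)})`. -/
theorem stmt_11 (M N : ℕ) (hM : 1 ≤ M) (hN : 2 ≤ N)
    (Φ : Matrix (Fin M) (Fin N) ℝ)
    (hunit : ∀ n : Fin N, ∑ m : Fin M, Φ m n ^ 2 = 1) :
    ∃ i j : Fin N, i ≠ j ∧
      Real.cos (Real.pi *
          ((((M : ℝ) - 1) * Real.Gamma (((M : ℝ) - 1) / 2)) /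
              ((N : ℝ) * Real.sqrt Real.pi * Real.Gamma ((M : ℝ) / 2)))
            ^ ((1 : ℝ) / ((M : ℝ) - 1)))
        ≤ |∑ m : Fin M, Φ m i * Φ m j| := by
  have hpi := Real.pi_pos
  have hne : (Finset.univ.filter fun p : Fin N × Fin N ↦ p.1 ≠ p.2).Nonempty :=
    ⟨(⟨0, by omega⟩, ⟨1, by omega⟩), by simp⟩
  obtain ⟨⟨i, j⟩, hij, hmax⟩ := Finset.exists_max_image _
    (fun p : Fin N × Fin N ↦ |∑ m : Fin M, Φ m p.1 * Φ m p.2|) hne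
  simp only [Finset.mem_filter, Finset.mem_univ, true_and, Prod.forall] at hij hmax
  refine ⟨i, j, hij, ?_⟩
  obtain ⟨n, rfl⟩ : ∃ n, M = n + 1 := ⟨M - 1, by omega⟩
  rcases Nat.eq_zero_or_pos n with rfl | hn
  · refine le_trans ?_ (abs_nonneg _)
    simp
  let u : Fin N → EuclideanSpace ℝ (Fin (n + 1)) := fun k ↦ WithLp.toLp 2 fun m ↦ Φ m k
  have hu : ∀ k, ‖u k‖ = 1 := fun k ↦ by
    simp [u, EuclideanSpace.norm_eq, hunit]
  have hinner : ∀ k l, inner ℝ (u k) (u l) = ∑ m, Φ m k * Φ m l := fun k l ↦ by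
    simp [u, PiLp.inner_apply, mul_comm]
  set μ := |∑ m, Φ m i * Φ m j| with hμ
  have hμ0 : 0 ≤ μ := abs_nonneg _
  have hμ1 : μ ≤ 1 := by
    have := abs_real_inner_le_norm (u i) (u j)
    rwa [hinner, hu, hu, mul_one] at this
  have hδ := arccos_le_of_abs_inner_le hn (by omega : 1 ≤ N) (by simp) hu hμ0
    fun k l hkl ↦ by rw [hinner]; exact hmax k l hkl
  have hα := rpow_one_div_le_three_halves hn hN
  push_cast
  rw [add_sub_cancel_right]
  set α := ((n * Real.Gamma ((n : ℝ) / 2)) /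
      (N * Real.sqrt Real.pi * Real.Gamma (((n : ℝ) + 1) / 2))) ^ ((1 : ℝ) / n)
  rcases le_total (Real.pi * α) Real.pi with hle | hge
  · calc _ ≤ Real.cos (Real.arccos μ) :=
          Real.cos_le_cos_of_nonneg_of_le_pi (Real.arccos_nonneg _) hle hδ
      _ = μ := Real.cos_arccos (by linarith) hμ1
  · refine le_trans (Real.cos_nonpos_of_pi_div_two_le_of_le (by linarith) ?_) hμ0
    nlinarith
end
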